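/- Let K ⊂ ℝⁿ be a compact convex set with nonempty interior and let f : K → ℝ be a Lipschitz function satisfying ∫_K f(x)·ρ(x) dx = 0, where ρ(x) = dist(x, ∂K). Then ∫_K |f(x)|·ρ(x) dx ≤ C·diam(K)·∫_K |∇f(x)|·ρ(x) dx, where C > 0 is a universal constant, diam(K) is the Euclidean diameter of K, and ∇f is the almost-everywhere defined gradient of f. -/

import Mathlib

open MeasureTheory Metric

open Set in
/-- The one-dimensional Brunn–Minkowski inequality. -/
theorem volume_add_le_of_convex_comb {s t : ℝ} (hs : 0 < s) (ht : 0 < t) (hst : s + t = 1)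
    {A B H : Set ℝ} (hA : MeasurableSet A) (hB : MeasurableSet B)
    (hA' : A.Nonempty) (hB' : B.Nonempty)
    (hH : ∀ x ∈ A, ∀ y ∈ B, s * x + t * y ∈ H) :
    ENNReal.ofReal s * volume A + ENNReal.ofReal t * volume B ≤ volume H := by
  have key : ∀ P ⊆ A, IsCompact P → P.Nonempty → ∀ Q ⊆ B, IsCompact Q → Q.Nonempty →
      ENNReal.ofReal s * volume P + ENNReal.ofReal t * volume Q ≤ volume H := by
    intro P hPA hP hP' Q hQB hQ hQ'
    obtain ⟨a, haP, ha⟩ := hP.exists_isGreatest hP'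
    obtain ⟨b, hbQ, hb⟩ := hQ.exists_isLeast hQ'
    have h1 := Measure.addHaar_image_homothety (volume : Measure ℝ) b s P
    have h2 := Measure.addHaar_image_homothety (volume : Measure ℝ) a t Q
    simp only [Module.finrank_self, pow_one, abs_of_pos hs, abs_of_pos ht] at h1 h2
    have hQm : MeasurableSet ((AffineMap.homothety a t : ℝ →ᵃ[ℝ] ℝ) '' Q) :=
      (hQ.image (AffineMap.homothety_continuous a t)).measurableSet
    rw [← h1, ← h2, ← measure_union₀ hQm.nullMeasurableSet]
    · refine measure_mono ?_
      rintro _ (⟨x, hx, rfl⟩ | ⟨y, hy, rfl⟩)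
      · convert hH x (hPA hx) b (hQB hbQ) using 1
        simp only [AffineMap.homothety_apply, vsub_eq_sub, vadd_eq_add, smul_eq_mul]
        linear_combination (-b) * hst
      · convert hH a (hPA haP) y (hQB hy) using 1
        simp only [AffineMap.homothety_apply, vsub_eq_sub, vadd_eq_add, smul_eq_mul]
        linear_combination (-a) * hst
    · refine measure_mono_null (t := {s * a + t * b}) ?_ (by simp)
      rintro z ⟨⟨x, hx, rfl⟩, ⟨y, hy, hxy⟩⟩
      simp only [AffineMap.homothety_apply, vsub_eq_sub, vadd_eq_add, smul_eq_mul] at hxy ⊢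
      have hx' := ha hx
      have hy' := hb hy
      have e1 := mul_le_mul_of_nonneg_left hx' hs.le
      have e2 := mul_le_mul_of_nonneg_left hy' ht.le
      obtain rfl : s = 1 - t := by linarith
      simp only [mem_singleton_iff]
      nlinarith
  obtain ⟨a₀, ha₀⟩ := hA'
  obtain ⟨b₀, hb₀⟩ := hB'
  rw [hA.measure_eq_iSup_isCompact, hB.measure_eq_iSup_isCompact]
  simp only [ENNReal.mul_iSup, iSup_and']
  refine ENNReal.biSup_add_biSup_le' ⟨∅, by simp⟩ ⟨∅, by simp⟩ fun P hP Q hQ => ?_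
  refine le_trans ?_ (key (insert a₀ P) (insert_subset ha₀ hP.1) (hP.2.insert a₀)
    (insert_nonempty _ _) (insert b₀ Q) (insert_subset hb₀ hQ.1) (hQ.2.insert b₀)
    (insert_nonempty _ _))
  gcongr <;> exact subset_insert _ _

open scoped ENNReal

theorem ENNReal.rpow_mul_rpow_le_add {s t : ℝ} (hs : 0 < s) (ht : 0 < t) (hst : s + t = 1)
    (a b : ℝ≥0∞) : a ^ s * b ^ t ≤ ENNReal.ofReal s * a + ENNReal.ofReal t * b := by
  induction a with
  | top => simp [ENNReal.mul_top, hs]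
  | coe a =>
  induction b with
  | top => simp [ENNReal.mul_top, ht]
  | coe b =>
  have := NNReal.geom_mean_le_arith_mean2_weighted s.toNNReal t.toNNReal a b
    (by rw [← Real.toNNReal_add hs.le ht.le, hst, Real.toNNReal_one])
  rw [Real.coe_toNNReal _ hs.le, Real.coe_toNNReal _ ht.le] at this
  rw [← ENNReal.coe_rpow_of_nonneg _ hs.le, ← ENNReal.coe_rpow_of_nonneg _ ht.le]
  rw [ENNReal.ofReal, ENNReal.ofReal]
  exact_mod_cast this

theorem lintegral_eq_lintegral_meas_lt_of_le_one {f : ℝ → ℝ≥0∞} (hf : Measurable f)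
    (hf1 : ∀ x, f x ≤ 1) :
    ∫⁻ x, f x = ∫⁻ r in Set.Ioo (0 : ℝ) 1, volume {x | ENNReal.ofReal r < f x} := by
  have hne : ∀ x, f x ≠ ∞ := fun x => ((hf1 x).trans_lt ENNReal.one_lt_top).ne
  have h := lintegral_eq_lintegral_meas_lt (volume : Measure ℝ) (f := fun x => (f x).toReal)
    (Filter.Eventually.of_forall fun x => ENNReal.toReal_nonneg) hf.ennreal_toReal.aemeasurable
  simp only [ENNReal.ofReal_toReal (hne _)] at h
  rw [h, ← lintegral_indicator measurableSet_Ioi, ← lintegral_indicator measurableSet_Ioo]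
  refine lintegral_congr_ae ?_
  filter_upwards with r
  by_cases hr : 0 < r
  · have e : {x | r < (f x).toReal} = {x | ENNReal.ofReal r < f x} := by
      ext x
      simp [ENNReal.ofReal_lt_iff_lt_toReal hr.le (hne x)]
    by_cases hr1 : r < 1
    · simp [hr, hr1, e]
    · have : {x | ENNReal.ofReal r < f x} = ∅ := by
        ext x
        simp only [Set.mem_ofPred_eq, Set.mem_empty_iff_false, iff_false, not_lt]
        exact (hf1 x).trans (by simpa using not_lt.1 hr1)
      simp [hr1, e, this]
  · simp [hr]

theorem prekopaLeindler_real_of_iSup_eq_one {s t : ℝ} (hs : 0 < s) (ht : 0 < t) (hst : s + t = 1)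
    {f g h : ℝ → ℝ≥0∞} (hf : Measurable f) (hg : Measurable g) (hh : Measurable h)
    (hf1 : ⨆ x, f x = 1) (hg1 : ⨆ x, g x = 1)
    (H : ∀ x y, f x ^ s * g y ^ t ≤ h (s * x + t * y)) :
    (∫⁻ x, f x) ^ s * (∫⁻ x, g x) ^ t ≤ ∫⁻ x, h x := by
  have hf1' : ∀ x, f x ≤ 1 := fun x => hf1 ▸ le_iSup f x
  have hg1' : ∀ x, g x ≤ 1 := fun x => hg1 ▸ le_iSup g x
  refine (ENNReal.rpow_mul_rpow_le_add hs ht hst _ _).trans ?_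
  refine le_trans ?_ (lintegral_mono (fun x => min_le_left (h x) 1))
  rw [lintegral_eq_lintegral_meas_lt_of_le_one hf hf1',
    lintegral_eq_lintegral_meas_lt_of_le_one hg hg1',
    lintegral_eq_lintegral_meas_lt_of_le_one (hh.min measurable_const) (fun x => min_le_right _ _),
    ← lintegral_const_mul' _ _ ENNReal.ofReal_ne_top,
    ← lintegral_const_mul' _ _ ENNReal.ofReal_ne_top, ← lintegral_add_left]
  · refine setLIntegral_mono' measurableSet_Ioo fun r hr => ?_
    have hr1 : ENNReal.ofReal r < 1 := by simpa using hr.2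
    obtain ⟨x₀, hx₀⟩ := lt_iSup_iff.1 (hr1.trans_eq hf1.symm)
    obtain ⟨y₀, hy₀⟩ := lt_iSup_iff.1 (hr1.trans_eq hg1.symm)
    refine volume_add_le_of_convex_comb hs ht hst (measurableSet_lt measurable_const hf)
      (measurableSet_lt measurable_const hg) ⟨x₀, hx₀⟩ ⟨y₀, hy₀⟩ fun x hx y hy => ?_
    refine lt_min (lt_of_lt_of_le ?_ (H x y)) hr1
    calc ENNReal.ofReal r = ENNReal.ofReal r ^ s * ENNReal.ofReal r ^ t := by
          rw [← ENNReal.rpow_add_of_nonneg _ _ hs.le ht.le, hst, ENNReal.rpow_one]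
      _ < f x ^ s * g y ^ t :=
          ENNReal.mul_lt_mul (ENNReal.rpow_lt_rpow hx hs) (ENNReal.rpow_lt_rpow hy ht)
  · refine Measurable.const_mul ?_ _
    have : Antitone fun r : ℝ => volume {x | ENNReal.ofReal r < f x} := fun a b hab =>
      measure_mono fun x (hx : ENNReal.ofReal b < f x) =>
        (ENNReal.ofReal_le_ofReal hab).trans_lt hx
    exact this.measurable

theorem prekopaLeindler_real_of_bounded {s t : ℝ} (hs : 0 < s) (ht : 0 < t) (hst : s + t = 1)
    {f g h : ℝ → ℝ≥0∞} (hf : Measurable f) (hg : Measurable g) (hh : Measurable h)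
    (hf1 : ⨆ x, f x ≠ ∞) (hg1 : ⨆ x, g x ≠ ∞)
    (H : ∀ x y, f x ^ s * g y ^ t ≤ h (s * x + t * y)) :
    (∫⁻ x, f x) ^ s * (∫⁻ x, g x) ^ t ≤ ∫⁻ x, h x := by
  set a := ⨆ x, f x
  set b := ⨆ x, g x
  by_cases ha : a = 0
  · have : ∀ x, f x = 0 := by simpa [a] using ha
    simp [this, hs]
  by_cases hb : b = 0
  · have : ∀ x, g x = 0 := by simpa [b] using hb
    simp [this, ht]
  have hc0 : a ^ s * b ^ t ≠ 0 := by simp [ha, hb, hf1, hg1]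
  have hct : a ^ s * b ^ t ≠ ∞ := ENNReal.mul_ne_top
    (ENNReal.rpow_ne_top_of_nonneg hs.le hf1) (ENNReal.rpow_ne_top_of_nonneg ht.le hg1)
  have e : ∀ x y : ℝ≥0∞, (x / a) ^ s * (y / b) ^ t = (x ^ s * y ^ t) / (a ^ s * b ^ t) := by
    intro x y
    rw [ENNReal.div_rpow_of_nonneg _ _ hs.le, ENNReal.div_rpow_of_nonneg _ _ ht.le, div_eq_mul_inv,
      div_eq_mul_inv, div_eq_mul_inv, ENNReal.mul_inv]
    · ring
    · right; exact ENNReal.rpow_ne_top_of_nonneg ht.le hg1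
    · left; exact ENNReal.rpow_ne_top_of_nonneg hs.le hf1
  have := prekopaLeindler_real_of_iSup_eq_one hs ht hst (f := fun x => f x / a)
    (g := fun x => g x / b) (h := fun x => h x / (a ^ s * b ^ t))
    (hf.div_const _) (hg.div_const _) (hh.div_const _)
    (by rw [← ENNReal.iSup_div]; exact ENNReal.div_self ha hf1)
    (by rw [← ENNReal.iSup_div]; exact ENNReal.div_self hb hg1)
    (fun x y => by rw [e]; exact ENNReal.div_le_div_right (H x y) _)
  simp only [div_eq_mul_inv] at this e
  rw [lintegral_mul_const _ hf, lintegral_mul_const _ hg, lintegral_mul_const _ hh, e] at this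
  exact (ENNReal.mul_le_mul_iff_left (ENNReal.inv_ne_zero.2 hct) (ENNReal.inv_ne_top.2 hc0)).1 this

theorem prekopaLeindler_real {s t : ℝ} (hs : 0 < s) (ht : 0 < t) (hst : s + t = 1)
    {f g h : ℝ → ℝ≥0∞} (hf : Measurable f) (hg : Measurable g) (hh : Measurable h)
    (H : ∀ x y, f x ^ s * g y ^ t ≤ h (s * x + t * y)) :
    (∫⁻ x, f x) ^ s * (∫⁻ x, g x) ^ t ≤ ∫⁻ x, h x := by
  have tr : ∀ u : ℝ → ℝ≥0∞, Measurable u → ∀ p : ℝ, 0 < p →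
      (∫⁻ x, u x) ^ p = ⨆ n : ℕ, (∫⁻ x, min (u x) n) ^ p := by
    intro u hu p hp
    have h1 : ∫⁻ x, u x = ⨆ n : ℕ, ∫⁻ x, min (u x) n := by
      rw [← lintegral_iSup (fun n => hu.min measurable_const)]
      · refine lintegral_congr fun x => ?_
        rw [← inf_iSup_eq, ENNReal.iSup_natCast, inf_top_eq]
      · intro m n hmn x
        exact min_le_min_left _ (by exact_mod_cast hmn)
    rw [h1]
    exact (ENNReal.orderIsoRpow p hp).map_iSup _
  rw [tr f hf s hs, tr g hg t ht, ENNReal.iSup_mul]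
  refine iSup_le fun m => ?_
  rw [ENNReal.mul_iSup]
  refine iSup_le fun n => ?_
  refine prekopaLeindler_real_of_bounded hs ht hst (hf.min measurable_const)
    (hg.min measurable_const) hh ?_ ?_ fun x y => le_trans ?_ (H x y)
  · exact ((iSup_le fun x => min_le_right _ _).trans_lt (ENNReal.natCast_lt_top m)).ne
  · exact ((iSup_le fun x => min_le_right _ _).trans_lt (ENNReal.natCast_lt_top n)).ne
  · gcongr <;> exact min_le_left _ _

/-- The Prékopa–Leindler inequality on `Fin n → ℝ`, by induction on the dimension. -/
theorem prekopaLeindler_pi {s t : ℝ} (hs : 0 < s) (ht : 0 < t) (hst : s + t = 1) (n : ℕ)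
    {f g h : (Fin n → ℝ) → ℝ≥0∞} (hf : Measurable f) (hg : Measurable g) (hh : Measurable h)
    (H : ∀ x y, f x ^ s * g y ^ t ≤ h (s • x + t • y)) :
    (∫⁻ x, f x) ^ s * (∫⁻ x, g x) ^ t ≤ ∫⁻ x, h x := by
  induction n with
  | zero =>
    have := H default default
    rw [Subsingleton.elim (s • default + t • default) default] at this
    rw [volume_pi, Measure.pi_of_empty _ default]
    simpa only [lintegral_dirac] using this
  | succ n ih =>
    let e := (MeasurableEquiv.piFinSuccAbove (fun _ : Fin (n + 1) => ℝ) 0).symm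
    have hm := (volume_preserving_piFinSuccAbove (fun _ : Fin (n + 1) => ℝ) 0).symm
    have hi : ∀ u : (Fin (n + 1) → ℝ) → ℝ≥0∞, Measurable u →
        ∫⁻ x, u x = ∫⁻ a, ∫⁻ v, u (e (a, v)) := by
      intro u hu
      rw [← hm.lintegral_comp hu, Measure.volume_eq_prod, lintegral_prod]
      exact (hu.comp e.measurable).aemeasurable
    rw [hi f hf, hi g hg, hi h hh]
    have hml : ∀ u : (Fin (n + 1) → ℝ) → ℝ≥0∞, Measurable u →
        Measurable fun a => ∫⁻ v, u (e (a, v)) := fun u hu =>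
      (hu.comp e.measurable).lintegral_prod_right'
    refine prekopaLeindler_real hs ht hst (hml f hf) (hml g hg) (hml h hh) fun x y => ?_
    refine ih (hf.comp (e.measurable.comp measurable_prodMk_left))
      (hg.comp (e.measurable.comp measurable_prodMk_left))
      (hh.comp (e.measurable.comp measurable_prodMk_left)) fun v w => ?_
    convert H (e (x, v)) (e (y, w)) using 2
    funext i
    refine Fin.cases ?_ (fun j => ?_) i <;>
      simp [e, MeasurableEquiv.piFinSuccAbove, Fin.insertNthEquiv]

theorem prekopaLeindler_euclideanSpace {s t : ℝ} (hs : 0 < s) (ht : 0 < t) (hst : s + t = 1)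
    {n : ℕ} {f g h : EuclideanSpace ℝ (Fin n) → ℝ≥0∞}
    (hf : Measurable f) (hg : Measurable g) (hh : Measurable h)
    (H : ∀ x y, f x ^ s * g y ^ t ≤ h (s • x + t • y)) :
    (∫⁻ x, f x) ^ s * (∫⁻ x, g x) ^ t ≤ ∫⁻ x, h x := by
  have hm := PiLp.volume_preserving_toLp (Fin n)
  rw [← hm.lintegral_comp hf, ← hm.lintegral_comp hg, ← hm.lintegral_comp hh]
  exact prekopaLeindler_pi hs ht hst n (hf.comp hm.measurable) (hg.comp hm.measurable)
    (hh.comp hm.measurable) fun x y => H _ _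

theorem closedBall_infDist_frontier_subset {E : Type*} [NormedAddCommGroup E] [NormedSpace ℝ E]
    {K : Set E} (hK : IsClosed K) {x : E} (hx : x ∈ K) :
    closedBall x (infDist x (frontier K)) ⊆ K := by
  rcases infDist_nonneg (x := x) (s := frontier K) |>.eq_or_lt with h | h
  · rw [← h, closedBall_zero]
    simpa using hx
  have hd := disjoint_ball_infDist (x := x) (s := frontier K)
  have hxb : x ∈ ball x (infDist x (frontier K)) := mem_ball_self h
  have hxi : x ∈ interior K := by
    by_contra hxi
    exact Set.disjoint_left.1 hd hxb ⟨subset_closure hx, hxi⟩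
  have hsub : ball x (infDist x (frontier K)) ⊆ interior K := by
    refine (convex_ball x _).isPreconnected.subset_left_of_subset_union isOpen_interior
      hK.isOpen_compl (Set.disjoint_left.2 fun y hy hy' => hy' (interior_subset hy))
      (fun y hy => ?_) ⟨x, hxb, hxi⟩
    by_contra hy'
    simp only [Set.mem_union, Set.mem_compl_iff, not_or, not_not] at hy'
    exact Set.disjoint_left.1 hd hy ⟨subset_closure hy'.2, hy'.1⟩
  rw [← closure_ball x h.ne']
  exact closure_minimal (hsub.trans interior_subset) hK

theorem Convex.concaveOn_infDist_frontier {E : Type*} [NormedAddCommGroup E] [NormedSpace ℝ E]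
    {K : Set E} (hK : IsClosed K) (hc : Convex ℝ K) :
    ConcaveOn ℝ K fun x => infDist x (frontier K) := by
  refine ⟨hc, fun x hx y hy s t hs ht hst => ?_⟩
  rcases (frontier K).eq_empty_or_nonempty with he | hne
  · simp [he]
  simp only [smul_eq_mul]
  set a := infDist x (frontier K)
  set b := infDist y (frontier K)
  have ha : 0 ≤ a := infDist_nonneg
  have hb : 0 ≤ b := infDist_nonneg
  refine (le_infDist hne).2 fun w hw => ?_
  by_contra! hlt
  have hr : 0 < s * a + t * b := dist_nonneg.trans_lt hlt
  have hsub : ball (s • x + t • y) (s * a + t * b) ⊆ K := by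
    intro z hz
    set r := s * a + t * b
    set v := z - (s • x + t • y)
    have hv : ‖v‖ ≤ r := by
      rw [mem_ball, dist_eq_norm] at hz
      exact hz.le
    have hmem : ∀ c, 0 ≤ c → ∀ p, p + (c / r) • v ∈ closedBall p c := by
      intro c hc p
      rw [mem_closedBall, dist_self_add_left, norm_smul, Real.norm_of_nonneg (by positivity),
        div_mul_eq_mul_div, div_le_iff₀ hr]
      gcongr
    have h1 := closedBall_infDist_frontier_subset hK hx (hmem a ha x)
    have h2 := closedBall_infDist_frontier_subset hK hy (hmem b hb y)
    have h3 := hc h1 h2 hs ht hst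
    convert h3 using 1
    have e : s * (a / r) + t * (b / r) = 1 := by
      rw [← mul_div_assoc, ← mul_div_assoc, ← add_div, div_self hr.ne']
    calc z = s • x + t • y + (1 : ℝ) • v := by simp [v]
      _ = _ := by rw [← e]; module
  exact hw.2 (interior_maximal hsub isOpen_ball (mem_ball'.2 hlt))

/-- A measure with concave density on a convex set is log-concave. -/
theorem rpow_mul_rpow_measure_le_of_concaveOn {n : ℕ} {K : Set (EuclideanSpace ℝ (Fin n))}
    (hKm : MeasurableSet K) {ρ : EuclideanSpace ℝ (Fin n) → ℝ} (hρ0 : ∀ x, 0 ≤ ρ x)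
    (hρ : Measurable ρ) (hcc : ConcaveOn ℝ K ρ) {s t : ℝ} (hs : 0 < s) (ht : 0 < t)
    (hst : s + t = 1) {A H : Set (EuclideanSpace ℝ (Fin n))}
    (hA : MeasurableSet A) (hH : MeasurableSet H)
    (h : ∀ x ∈ A ∩ K, ∀ y ∈ K, s • x + t • y ∈ H) :
    let μ := (volume.restrict K).withDensity fun x => ENNReal.ofReal (ρ x)
    μ A ^ s * μ Set.univ ^ t ≤ μ H := by
  intro μ
  have hm : ∀ S, MeasurableSet S →
      μ S = ∫⁻ x, (S ∩ K).indicator (fun x => ENNReal.ofReal (ρ x)) x := by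
    intro S hS
    rw [withDensity_apply _ hS, Measure.restrict_restrict hS, lintegral_indicator (hS.inter hKm)]
  rw [hm A hA, hm H hH, hm _ MeasurableSet.univ]
  refine prekopaLeindler_euclideanSpace hs ht hst (hρ.ennreal_ofReal.indicator (hA.inter hKm))
    (hρ.ennreal_ofReal.indicator (MeasurableSet.univ.inter hKm))
    (hρ.ennreal_ofReal.indicator (hH.inter hKm)) fun x y => ?_
  by_cases hx : x ∈ A ∩ K
  swap; · simp [Set.indicator_of_notMem hx, hs]
  by_cases hy : y ∈ K
  swap; · simp [hy, ht]
  have hz : s • x + t • y ∈ H ∩ K := ⟨h x hx y hy, hcc.1 hx.2 hy hs.le ht.le hst⟩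
  rw [Set.indicator_of_mem hx, Set.indicator_of_mem hz, Set.indicator_of_mem (by simpa using hy)]
  refine (ENNReal.rpow_mul_rpow_le_add hs ht hst _ _).trans ?_
  rw [← ENNReal.ofReal_mul hs.le, ← ENNReal.ofReal_mul ht.le,
    ← ENNReal.ofReal_add (mul_nonneg hs.le (hρ0 x)) (mul_nonneg ht.le (hρ0 y))]
  exact ENNReal.ofReal_le_ofReal (hcc.2 hx.2 hy hs.le ht.le hst)

theorem LipschitzWith.le_add_mul_norm {E : Type*} [NormedAddCommGroup E] {g : E → ℝ}
    {L : NNReal} (hg : LipschitzWith L g) (x v : E) :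
    g (x + v) ≤ g x + L * ‖v‖ := by
  simpa using hg.le_add_mul (x + v) x

/-- The supremum of `g` over the closed ball of radius `r` around `x`. -/
noncomputable def ballSup {E : Type*} [NormedAddCommGroup E] [NormedSpace ℝ E]
    (g : E → ℝ) (r : ℝ) (x : E) : ℝ :=
  ⨆ u : closedBall (0 : E) 1, g (x + r • (u : E))

section ballSup

variable {E : Type*} [NormedAddCommGroup E] [NormedSpace ℝ E] {g : E → ℝ} {L : NNReal} {r : ℝ}

instance : Nonempty (closedBall (0 : E) 1) := ⟨⟨0, by simp⟩⟩

theorem ballSup_le_of_forall {x : E} {c : ℝ} (hr : 0 ≤ r) (h : ∀ v, ‖v‖ ≤ r → g (x + v) ≤ c) :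
    ballSup g r x ≤ c := by
  refine ciSup_le fun u => h _ ?_
  have := mem_closedBall_zero_iff.1 u.2
  rw [norm_smul, Real.norm_of_nonneg hr]
  exact mul_le_of_le_one_right hr this

theorem le_ballSup (hg : LipschitzWith L g) (hr : 0 ≤ r) (x : E) {v : E} (hv : ‖v‖ ≤ r) :
    g (x + v) ≤ ballSup g r x := by
  have hb : BddAbove (Set.range fun u : closedBall (0 : E) 1 => g (x + r • (u : E))) := by
    refine ⟨g x + L * r, ?_⟩
    rintro _ ⟨u, rfl⟩
    refine (hg.le_add_mul_norm x _).trans ?_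
    have := mem_closedBall_zero_iff.1 u.2
    rw [norm_smul, Real.norm_of_nonneg hr]
    gcongr
    exact mul_le_of_le_one_right hr this
  rcases hr.eq_or_lt with rfl | hr'
  · have : v = 0 := by simpa using hv
    subst this
    refine le_trans (le_of_eq ?_) (le_ciSup hb ⟨0, by simp⟩)
    simp
  · have hu : r⁻¹ • v ∈ closedBall (0 : E) 1 := by
      rw [mem_closedBall_zero_iff, norm_smul, Real.norm_of_nonneg (by positivity),
        inv_mul_le_iff₀ hr', mul_one]
      exact hv
    refine le_trans (le_of_eq ?_) (le_ciSup hb ⟨_, hu⟩)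
    simp [smul_smul, hr'.ne']

theorem self_le_ballSup (hg : LipschitzWith L g) (hr : 0 ≤ r) (x : E) : g x ≤ ballSup g r x := by
  simpa using le_ballSup hg hr x (v := 0) (by simpa using hr)

theorem ballSup_le_add (hg : LipschitzWith L g) (hr : 0 ≤ r) (x : E) :
    ballSup g r x ≤ g x + L * r :=
  ballSup_le_of_forall hr fun v hv => (hg.le_add_mul_norm x v).trans (by gcongr)

theorem lipschitzWith_ballSup (hg : LipschitzWith L g) (hr : 0 ≤ r) :
    LipschitzWith L (ballSup g r) :=
  LipschitzWith.of_le_add_mul L fun x y => ballSup_le_of_forall hr fun v hv => by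
    have h1 := hg.le_add_mul (x + v) (y + v)
    rw [dist_add_right] at h1
    linarith [le_ballSup hg hr y hv]

open Filter Topology in
theorem tendsto_max_ballSup_sub_div {D : ℝ} (hD : 0 ≤ D) {x : E} (hx : DifferentiableAt ℝ g x) :
    Tendsto (fun t => max ((ballSup g (t * D) x - g x) / t) (D * ‖fderiv ℝ g x‖)) (𝓝[>] 0)
      (𝓝 (D * ‖fderiv ℝ g x‖)) := by
  rw [tendsto_order]
  refine ⟨fun a ha => Eventually.of_forall fun t => lt_max_of_lt_right ha, fun a ha => ?_⟩
  obtain ⟨ε, hε, hεa⟩ : ∃ ε > 0, D * (‖fderiv ℝ g x‖ + ε) < a := by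
    refine ⟨(a - D * ‖fderiv ℝ g x‖) / (2 * (D + 1)), div_pos (by linarith) (by positivity), ?_⟩
    have : D / (2 * (D + 1)) ≤ 1 / 2 := by
      rw [div_le_div_iff₀ (by positivity) (by positivity)]; linarith
    have := mul_le_mul_of_nonneg_right this (sub_pos.2 ha).le
    calc _ = D * ‖fderiv ℝ g x‖ + D / (2 * (D + 1)) * (a - D * ‖fderiv ℝ g x‖) := by ring
      _ < a := by linarith
  have h := hx.hasFDerivAt
  rw [hasFDerivAt_iff_isLittleO_nhds_zero] at h
  have h' := h.def hε
  rw [Metric.eventually_nhds_iff] at h'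
  obtain ⟨δ, hδ, hδ'⟩ := h'
  have h0 : Tendsto (fun t : ℝ => t * D) (𝓝[>] 0) (𝓝 0) :=
    ((continuous_id.mul continuous_const).tendsto' 0 0 (by simp)).mono_left nhdsWithin_le_nhds
  filter_upwards [self_mem_nhdsWithin, h0.eventually_lt_const hδ] with t (ht : 0 < t) htδ
  refine max_lt (lt_of_le_of_lt ?_ hεa) ha
  rw [div_le_iff₀ ht, sub_le_iff_le_add]
  refine ballSup_le_of_forall (by positivity) fun v hv => ?_
  have h1 := (Real.le_norm_self _).trans (hδ' (y := v) (by simpa using hv.trans_lt htδ))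
  have h2 := (Real.le_norm_self _).trans ((fderiv ℝ g x).le_opNorm v)
  have h3 := mul_le_mul_of_nonneg_left hv (show 0 ≤ ‖fderiv ℝ g x‖ + ε by positivity)
  linarith

end ballSup

theorem one_add_mul_le_rpow_mul_rpow {p P M t : ℝ} (hp : 0 ≤ p) (hpP : p ≤ P) (hPM : P ≤ M)
    (hM : 0 < M) (ht : 0 < t) :
    (1 + t * (1 - P / M)) * p ≤ p ^ (1 - t) * M ^ t := by
  rcases hp.eq_or_lt with rfl | hp
  · simp only [mul_zero]; positivity
  have e : p ^ (1 - t) * M ^ t = (M / p) ^ t * p := by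
    rw [Real.rpow_sub hp, Real.rpow_one, Real.div_rpow hM.le hp.le]; ring
  rw [e]
  gcongr
  have h1 : P / M ≤ 1 := (div_le_one hM).2 hPM
  have hl : 1 - P / M ≤ Real.log (M / p) := by
    have h2 := Real.add_one_le_exp (-Real.log (M / p))
    rw [Real.exp_neg, Real.exp_log (by positivity), inv_div] at h2
    have : p / M ≤ P / M := by gcongr
    linarith
  calc 1 + t * (1 - P / M) ≤ t * Real.log (M / p) + 1 := by nlinarith
    _ ≤ Real.exp (t * Real.log (M / p)) := Real.add_one_le_exp _
    _ = (M / p) ^ t := by rw [Real.rpow_def_of_pos (by positivity), mul_comm]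

section WeightedInequality

variable {n : ℕ} {K : Set (EuclideanSpace ℝ (Fin n))}
  {μ : Measure (EuclideanSpace ℝ (Fin n))} [IsFiniteMeasure μ]
  {g : EuclideanSpace ℝ (Fin n) → ℝ} {L : NNReal}

theorem one_add_mul_integral_le_integral_ballSup [NeZero μ] (hK : IsCompact K)
    (hμ : ∀ s t : ℝ, 0 < s → 0 < t → s + t = 1 → ∀ A H, MeasurableSet A → MeasurableSet H →
      (∀ x ∈ A ∩ K, ∀ y ∈ K, s • x + t • y ∈ H) → μ A ^ s * μ Set.univ ^ t ≤ μ H)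
    (hg : LipschitzWith L g) (hg0 : ∀ x, 0 ≤ g x) (hgi : Integrable g μ)
    {t : ℝ} (ht : t ∈ Set.Ioo (0 : ℝ) 1) :
    (1 + t * (1 - μ.real {x | 0 < g x} / μ.real Set.univ)) * ∫ x, g x ∂μ ≤
      ∫ x, ballSup g (t * diam K) x ∂μ := by
  set P := μ.real {x | 0 < g x}
  set M := μ.real Set.univ
  set r := t * diam K
  have hr : 0 ≤ r := mul_nonneg ht.1.le diam_nonneg
  have hM : 0 < M := measureReal_univ_pos
  have hPM : P ≤ M := measureReal_mono (Set.subset_univ _)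
  have hc : 0 ≤ 1 + t * (1 - P / M) := by
    have : P / M ≤ 1 := (div_le_one hM).2 hPM
    have := mul_nonneg ht.1.le (sub_nonneg.2 this)
    linarith
  have hh0 : ∀ x, 0 ≤ ballSup g r x := fun x => (hg0 x).trans (self_le_ballSup hg hr x)
  have hhc : Continuous (ballSup g r) := (lipschitzWith_ballSup hg hr).continuous
  have hhi : Integrable (ballSup g r) μ :=
    (hgi.add (integrable_const (L * r))).mono' hhc.aestronglyMeasurable <| by
      filter_upwards with x
      rw [Real.norm_of_nonneg (hh0 x)]
      exact ballSup_le_add hg hr x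
  have hlev : ∀ σ : ℝ, 0 < σ → ENNReal.ofReal (1 + t * (1 - P / M)) * μ {x | σ < g x} ≤
      μ {x | σ < ballSup g r x} := by
    intro σ hσ
    refine le_trans ?_ (hμ (1 - t) t (by linarith [ht.2]) ht.1 (by ring) {x | σ < g x} _
      (measurableSet_lt measurable_const hg.continuous.measurable)
      (measurableSet_lt measurable_const hhc.measurable) fun x hx y hy => ?_)
    · have hp : μ.real {x | σ < g x} ≤ P := measureReal_mono fun x hx => hσ.trans hx
      have := ENNReal.ofReal_le_ofReal
        (one_add_mul_le_rpow_mul_rpow measureReal_nonneg hp hPM hM ht.1)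
      rwa [ENNReal.ofReal_mul hc, ENNReal.ofReal_mul (by positivity),
        ← ENNReal.ofReal_rpow_of_nonneg measureReal_nonneg (by linarith [ht.2]),
        ← ENNReal.ofReal_rpow_of_nonneg measureReal_nonneg ht.1.le, ofReal_measureReal,
        ofReal_measureReal] at this
    · have hxσ : σ < g x := hx.1
      have hv : ‖t • (x - y)‖ ≤ r := by
        rw [norm_smul, Real.norm_of_nonneg ht.1.le, ← dist_eq_norm]
        exact mul_le_mul_of_nonneg_left (dist_le_diam_of_mem hK.isBounded hx.2 hy) ht.1.le
      have := le_ballSup hg hr ((1 - t) • x + t • y) hv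
      have e : (1 - t) • x + t • y + t • (x - y) = x := by module
      rw [e] at this
      exact hxσ.trans_le this
  rw [← ENNReal.ofReal_le_ofReal_iff (integral_nonneg hh0), ENNReal.ofReal_mul hc,
    ofReal_integral_eq_lintegral_ofReal hgi (Filter.Eventually.of_forall hg0),
    ofReal_integral_eq_lintegral_ofReal hhi (Filter.Eventually.of_forall hh0),
    lintegral_eq_lintegral_meas_lt _ (Filter.Eventually.of_forall hg0)
      hg.continuous.measurable.aemeasurable,
    lintegral_eq_lintegral_meas_lt _ (Filter.Eventually.of_forall hh0)
      hhc.measurable.aemeasurable, ← lintegral_const_mul' _ _ ENNReal.ofReal_ne_top]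
  exact setLIntegral_mono' measurableSet_Ioi hlev

open Filter Topology in
theorem integral_le_diam_mul_integral_norm_fderiv [NeZero μ] (hK : IsCompact K)
    (hac : μ ≪ volume)
    (hμ : ∀ s t : ℝ, 0 < s → 0 < t → s + t = 1 → ∀ A H, MeasurableSet A → MeasurableSet H →
      (∀ x ∈ A ∩ K, ∀ y ∈ K, s • x + t • y ∈ H) → μ A ^ s * μ Set.univ ^ t ≤ μ H)
    (hg : LipschitzWith L g) (hg0 : ∀ x, 0 ≤ g x) (hgi : Integrable g μ) :
    (1 - μ.real {x | 0 < g x} / μ.real Set.univ) * ∫ x, g x ∂μ ≤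
      diam K * ∫ x, ‖fderiv ℝ g x‖ ∂μ := by
  have hD : 0 ≤ diam K := diam_nonneg
  set F := fun (t : ℝ) x => max ((ballSup g (t * diam K) x - g x) / t) (diam K * ‖fderiv ℝ g x‖)
  have hmeas : ∀ t > 0, Measurable (F t) := fun t ht =>
    ((((lipschitzWith_ballSup hg (mul_nonneg ht.le hD)).continuous.sub
      hg.continuous).div_const t).measurable).max ((measurable_fderiv ℝ g).norm.const_mul _)
  have hbound : ∀ t > 0, ∀ x, ‖F t x‖ ≤ L * diam K := by
    intro t ht x
    rw [Real.norm_of_nonneg (le_max_of_le_right (by positivity))]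
    refine max_le ?_ ?_
    · rw [div_le_iff₀ ht]
      linarith [ballSup_le_add hg (mul_nonneg ht.le hD) x]
    · rw [mul_comm]
      gcongr
      exact norm_fderiv_le_of_lipschitz ℝ hg
  have hlim : Tendsto (fun t => ∫ x, F t x ∂μ) (𝓝[>] 0)
      (𝓝 (∫ x, diam K * ‖fderiv ℝ g x‖ ∂μ)) := by
    refine tendsto_integral_filter_of_dominated_convergence (fun _ => L * diam K) ?_ ?_
      (integrable_const _) ?_
    · filter_upwards [self_mem_nhdsWithin] with t ht using (hmeas t ht).aestronglyMeasurable
    · filter_upwards [self_mem_nhdsWithin] with t ht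
      exact Eventually.of_forall (hbound t ht)
    · filter_upwards [hac.ae_le hg.ae_differentiableAt] with x hx
      exact tendsto_max_ballSup_sub_div hD hx
  rw [← integral_const_mul (diam K)]
  refine ge_of_tendsto hlim ?_
  filter_upwards [Ioo_mem_nhdsGT (zero_lt_one' ℝ)] with t ht
  have h1 := one_add_mul_integral_le_integral_ballSup hK hμ hg hg0 hgi ht
  have hFi : Integrable (F t) μ := (integrable_const (L * diam K : ℝ)).mono'
    (hmeas t ht.1).aestronglyMeasurable (Eventually.of_forall (hbound t ht.1))
  have h2 : ∫ x, ballSup g (t * diam K) x ∂μ ≤ ∫ x, (g x + t * F t x) ∂μ := by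
    refine integral_mono_of_nonneg (Eventually.of_forall fun x =>
      (hg0 x).trans (self_le_ballSup hg (mul_nonneg ht.1.le hD) x))
      (hgi.add (hFi.const_mul t)) (Eventually.of_forall fun x => ?_)
    have : (ballSup g (t * diam K) x - g x) / t ≤ F t x := le_max_left _ _
    rw [div_le_iff₀ ht.1] at this
    simp only
    linarith
  rw [integral_add hgi (hFi.const_mul t), integral_const_mul] at h2
  refine le_of_mul_le_mul_left ?_ ht.1
  linarith

theorem norm_fderiv_posPart_add_norm_fderiv_negPart_le {E : Type*} [NormedAddCommGroup E]
    [NormedSpace ℝ E] {f : E → ℝ} (hf : Continuous f) (x : E) :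
    ‖fderiv ℝ (fun y => max (f y) 0) x‖ + ‖fderiv ℝ (fun y => max (-f y) 0) x‖ ≤
      ‖fderiv ℝ f x‖ := by
  rcases lt_trichotomy (f x) 0 with h | h | h
  · have h' := hf.continuousAt.eventually_lt_const h
    have e1 : (fun y => max (f y) 0) =ᶠ[nhds x] fun _ => 0 := by
      filter_upwards [h'] with y hy using max_eq_right hy.le
    have e2 : (fun y => max (-f y) 0) =ᶠ[nhds x] fun y => -f y := by
      filter_upwards [h'] with y hy using max_eq_left (by linarith)
    rw [e1.fderiv_eq, e2.fderiv_eq, fderiv_fun_neg]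
    simp
  · have e1 : fderiv ℝ (fun y => max (f y) 0) x = 0 :=
      IsLocalMin.fderiv_eq_zero (Filter.Eventually.of_forall fun y => by simp [h])
    have e2 : fderiv ℝ (fun y => max (-f y) 0) x = 0 :=
      IsLocalMin.fderiv_eq_zero (Filter.Eventually.of_forall fun y => by simp [h])
    simp [e1, e2]
  · have h' := hf.continuousAt.eventually_const_lt h
    have e1 : (fun y => max (f y) 0) =ᶠ[nhds x] f := by
      filter_upwards [h'] with y hy using max_eq_left hy.le
    have e2 : (fun y => max (-f y) 0) =ᶠ[nhds x] fun _ => 0 := by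
      filter_upwards [h'] with y hy using max_eq_right (by linarith)
    rw [e1.fderiv_eq, e2.fderiv_eq]
    simp

theorem integral_abs_le_two_mul_diam_mul_integral_norm_fderiv (hK : IsCompact K)
    (hac : μ ≪ volume)
    (hμ : ∀ s t : ℝ, 0 < s → 0 < t → s + t = 1 → ∀ A H, MeasurableSet A → MeasurableSet H →
      (∀ x ∈ A ∩ K, ∀ y ∈ K, s • x + t • y ∈ H) → μ A ^ s * μ Set.univ ^ t ≤ μ H)
    (hg : LipschitzWith L g) (hgi : Integrable g μ) (hmean : ∫ x, g x ∂μ = 0) :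
    ∫ x, |g x| ∂μ ≤ 2 * diam K * ∫ x, ‖fderiv ℝ g x‖ ∂μ := by
  by_cases hμ0 : μ = 0
  · simp [hμ0]
  have : NeZero μ := ⟨hμ0⟩
  have hp : LipschitzWith L fun x => max (g x) 0 := hg.max_const 0
  have hn : LipschitzWith L fun x => max (-g x) 0 := hg.neg.max_const 0
  have hpi : Integrable (fun x => max (g x) 0) μ := hgi.pos_part
  have hni : Integrable (fun x => max (-g x) 0) μ := hgi.neg_part
  have h1 := integral_le_diam_mul_integral_norm_fderiv hK hac hμ hp
    (fun x => le_max_right _ _) hpi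
  have h2 := integral_le_diam_mul_integral_norm_fderiv hK hac hμ hn
    (fun x => le_max_right _ _) hni
  have hfi : ∀ {u : EuclideanSpace ℝ (Fin n) → ℝ}, LipschitzWith L u →
      Integrable (fun x => ‖fderiv ℝ u x‖) μ := fun {u} hu =>
    (integrable_const (L : ℝ)).mono' (measurable_fderiv ℝ u).norm.aestronglyMeasurable
      (Filter.Eventually.of_forall fun x => by
        rw [norm_norm]; exact norm_fderiv_le_of_lipschitz ℝ hu)
  have hsum : ∫ x, ‖fderiv ℝ (fun y => max (g y) 0) x‖ ∂μ +
      ∫ x, ‖fderiv ℝ (fun y => max (-g y) 0) x‖ ∂μ ≤ ∫ x, ‖fderiv ℝ g x‖ ∂μ := by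
    rw [← integral_add (hfi hp) (hfi hn)]
    exact integral_mono ((hfi hp).add (hfi hn)) (hfi hg)
      (norm_fderiv_posPart_add_norm_fderiv_negPart_le hg.continuous)
  have habs : ∫ x, |g x| ∂μ = ∫ x, max (g x) 0 ∂μ + ∫ x, max (-g x) 0 ∂μ := by
    rw [← integral_add hpi hni]
    refine integral_congr_ae (Filter.Eventually.of_forall fun x => ?_)
    rcases le_total (g x) 0 with h | h <;> simp [h, abs_of_nonneg, abs_of_nonpos]
  have hdiff : ∫ x, max (g x) 0 ∂μ - ∫ x, max (-g x) 0 ∂μ = 0 := by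
    rw [← integral_sub hpi hni]
    refine Eq.trans (integral_congr_ae (Filter.Eventually.of_forall fun x => ?_)) hmean
    rcases le_total (g x) 0 with h | h <;> simp [h]
  have hI : 0 ≤ ∫ x, max (g x) 0 ∂μ := integral_nonneg fun x => le_max_right _ _
  have hM : 0 < μ.real Set.univ := measureReal_univ_pos
  have hPQ : μ.real {x | 0 < max (g x) 0} / μ.real Set.univ +
      μ.real {x | 0 < max (-g x) 0} / μ.real Set.univ ≤ 1 := by
    rw [← add_div, div_le_one hM, ← measureReal_union]
    · exact measureReal_mono (Set.subset_univ _)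
    · refine Set.disjoint_left.2 fun x hx hx' => ?_
      simp only [Set.mem_ofPred_eq, lt_max_iff, lt_irrefl, or_false] at hx hx'
      linarith
    · exact measurableSet_lt measurable_const hn.continuous.measurable
  set a := ∫ x, max (g x) 0 ∂μ
  rw [habs]
  rw [← sub_eq_zero.1 hdiff] at h2 ⊢
  have h3 := mul_le_mul_of_nonneg_right hPQ hI
  have h4 := mul_le_mul_of_nonneg_left hsum (diam_nonneg (s := K))
  linarith

end WeightedInequality

/-- Chua–Wheeden weighted Poincaré inequality on convex domains: if a Lipschitz function
`f` has mean zero with respect to the weight `ρ(x) = dist(x, ∂K)`, then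
`∫_K |f| ρ ≤ C diam(K) ∫_K |∇f| ρ` for a universal constant `C`. -/
theorem chua_wheeden_poincare :
    ∃ C : ℝ, 0 < C ∧ ∀ (n : ℕ) (K : Set (EuclideanSpace ℝ (Fin n))),
      IsCompact K → Convex ℝ K → (interior K).Nonempty →
      ∀ f : EuclideanSpace ℝ (Fin n) → ℝ,
        (∃ M : NNReal, LipschitzOnWith M f K) →
        (∫ x in K, f x * infDist x (frontier K)) = 0 →
        (∫ x in K, |f x| * infDist x (frontier K)) ≤
          C * diam K * ∫ x in K, ‖gradient f x‖ * infDist x (frontier K) := by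
  refine ⟨2, two_pos, fun n K hK hconv _ f ⟨L, hf⟩ hmean => ?_⟩
  obtain ⟨g, hg, hfg⟩ := hf.extend_real
  set ρ := fun x => infDist x (frontier K)
  have hρ0 : ∀ x, 0 ≤ ρ x := fun x => infDist_nonneg
  have hρ : Continuous ρ := continuous_infDist_pt _
  have hρm := hρ.measurable.ennreal_ofReal
  have hKm := hK.measurableSet
  set μ := (volume.restrict K).withDensity fun x => ENNReal.ofReal (ρ x)
  have hint : ∀ u : EuclideanSpace ℝ (Fin n) → ℝ, ∫ x, u x ∂μ = ∫ x in K, u x * ρ x := by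
    intro u
    rw [integral_withDensity_eq_integral_toReal_smul hρm
      (Filter.Eventually.of_forall fun x => ENNReal.ofReal_lt_top)]
    simp only [ENNReal.toReal_ofReal (hρ0 _), smul_eq_mul, mul_comm]
  have : IsFiniteMeasure μ := isFiniteMeasure_withDensity_ofReal
    (hρ.continuousOn.integrableOn_compact hK).2
  have hgi : Integrable g μ := by
    rw [integrable_withDensity_iff hρm
      (Filter.Eventually.of_forall fun x => ENNReal.ofReal_lt_top)]
    simp only [ENNReal.toReal_ofReal (hρ0 _)]
    exact (hg.continuous.mul hρ).continuousOn.integrableOn_compact hK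
  have hgf : ∀ x ∈ K, ‖gradient f x‖ * ρ x = ‖fderiv ℝ g x‖ * ρ x := by
    intro x hx
    by_cases hxi : x ∈ interior K
    · have : f =ᶠ[nhds x] g := by
        filter_upwards [mem_interior_iff_mem_nhds.1 hxi] with y hy using hfg hy
      rw [gradient, LinearIsometryEquiv.norm_map, this.fderiv_eq]
    · have : ρ x = 0 := infDist_zero_of_mem ⟨subset_closure hx, hxi⟩
      simp [this]
  have key := integral_abs_le_two_mul_diam_mul_integral_norm_fderiv (μ := μ) hK
    ((withDensity_absolutelyContinuous _ _).trans Measure.restrict_le_self.absolutelyContinuous)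
    (fun s t hs ht hst A H hA hH h => rpow_mul_rpow_measure_le_of_concaveOn hKm hρ0 hρ.measurable
      (hconv.concaveOn_infDist_frontier hK.isClosed) hs ht hst hA hH h) hg hgi (by
        rw [hint, ← hmean]
        exact setIntegral_congr_fun hKm fun x hx => by simp only [hfg hx, ρ])
  rw [hint, hint] at key
  rw [setIntegral_congr_fun hKm hgf,
    setIntegral_congr_fun (g := fun x => |g x| * ρ x) hKm fun x hx => by simp only [hfg hx, ρ]]
  exact key
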